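/- Let X and Y be bounded self-adjoint operators on a complex Hilbert space such that XY = −YX. If Y is invertible, then X + Y is invertible. -/

import Mathlib

/-- Let `X` and `Y` be bounded self-adjoint operators on a complex Hilbert
space such that `XY = -YX`.  If `Y` is invertible, then `X + Y` is invertible. -/
theorem isUnit_add_of_anticommute {W : Type*} [NormedAddCommGroup W]
    [InnerProductSpace ℂ W] [CompleteSpace W] (X Y : W →L[ℂ] W)
    (hX : IsSelfAdjoint X) (hY : IsSelfAdjoint Y) (hanti : X * Y = -(Y * X))
    (hYunit : IsUnit Y) : IsUnit (X + Y) := by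
  have hsq : (X + Y) ^ 2 = X ^ 2 + Y ^ 2 := by
    simp only [sq, add_mul, mul_add, hanti]
    abel
  have hY2 : IsStrictlyPositive (Y ^ 2) :=
    IsStrictlyPositive.iff_of_unital.mpr ⟨hY.sq_nonneg, hYunit.pow 2⟩
  rw [← isUnit_pow_iff two_ne_zero, hsq]
  exact (hY2.nonneg_add hX.sq_nonneg).isUnit
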